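/- The graph B2 contains the wheel W_5 as an induced subgraph; consequently B2 is not 3-colourable and is not word-representable. -/

import Mathlib

/-- Two distinct letters `x` and `y` alternate in the word `w` if, after deleting all
letters other than `x` and `y` from `w`, no two consecutive letters of the resulting
word are equal (i.e. it reads `xyxy...` or `yxyx...`). -/
def Alternates {V : Type*} [DecidableEq V] (w : List V) (x y : V) : Prop :=
  List.Chain' (· ≠ ·) (w.filter fun z => z = x ∨ z = y)

/-- A finite simple graph `G = (V, E)` is word-representable if there is a word over the
alphabet `V` in which every element of `V` occurs at least once and such that, for all
distinct `x, y ∈ V`, the letters `x` and `y` alternate in the word iff `{x, y} ∈ E`. -/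
def WordRepresentable {V : Type*} [DecidableEq V] (G : SimpleGraph V) : Prop :=
  ∃ w : List V, (∀ v : V, v ∈ w) ∧
    ∀ x y : V, x ≠ y → (G.Adj x y ↔ Alternates w x y)

/-- The wheel graph `W_n` on `n + 1` vertices: a cycle on the `n` vertices `Sum.inl i`
(`i : Fin n`), together with one new hub vertex `Sum.inr ()` adjacent to all of them. -/
def wheelGraph (n : ℕ) : SimpleGraph (Fin n ⊕ Unit) :=
  SimpleGraph.fromRel fun a b =>
    match a, b with
    | Sum.inl i, Sum.inl j => ((i : ℕ) + 1) % n = (j : ℕ)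
    | Sum.inl _, Sum.inr _ => True
    | _, _ => False

/-- The simple graph on `V` whose edges are (the unordered versions of) the pairs
occurring in the list `l`. -/
def graphOfList {V : Type*} (l : List (V × V)) : SimpleGraph V :=
  SimpleGraph.fromRel fun a b => (a, b) ∈ l

def edgesB2 : List ((Fin 3 × Fin 3) × (Fin 3 × Fin 3)) :=
  [
    ((0, 0), (1, 0)), ((0, 0), (0, 1)), ((0, 1), (1, 1)), ((0, 1), (0, 2)), ((0, 2), (1, 2)),
    ((1, 0), (2, 0)), ((1, 1), (2, 1)), ((1, 1), (1, 2)), ((1, 2), (2, 2)), ((2, 0), (2, 1)),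
    ((2, 1), (2, 2)), ((0, 2), (1, 1)), ((1, 2), (2, 1)), ((0, 1), (1, 0)), ((0, 1), (2, 0)),
    ((1, 1), (2, 0))]

/-- The graph `B2` from the paper. -/
def graphB2 : SimpleGraph (Fin 3 × Fin 3) := graphOfList edgesB2

theorem adjB2_iff (a b : Fin 3 × Fin 3) :
    graphB2.Adj a b ↔ (a ≠ b ∧ ((a, b) ∈ edgesB2 ∨ (b, a) ∈ edgesB2)) := by
  unfold graphB2 graphOfList
  rw [SimpleGraph.fromRel_adj]

/-- `x` is ahead of `y` by 0 or 1 in every prefix. -/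
def Ahead {V : Type*} [DecidableEq V] (w : List V) (x y : V) : Prop :=
  ∀ p, p <+: w → (p.count y ≤ p.count x ∧ p.count x ≤ p.count y + 1)

theorem ahead_iff {V : Type*} [DecidableEq V] (w : List V) : ∀ (x y : V), x ≠ y →
    (Ahead w x y ↔ List.IsChain (· ≠ ·) (y :: w.filter fun z => z = x ∨ z = y)) := by
  induction w with
  | nil => intro x y h; simp [Ahead]
  | cons a t ih =>
    intro x y h
    by_cases hx : a = x
    · subst hx
      have e : (fun z => decide (z = a ∨ z = y)) = (fun z => decide (z = y ∨ z = a)) := by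
        funext z; simp [or_comm]
      rw [List.filter_cons_of_pos (by simp), List.isChain_cons_cons, e, ← ih y a h.symm]
      constructor
      · intro H
        refine ⟨h.symm, fun p hp => ?_⟩
        have := H (a :: p) (by simpa using hp)
        simp [h] at this
        omega
      · rintro ⟨-, H⟩ p hp
        rcases List.prefix_cons_iff.1 hp with rfl | ⟨q, rfl, hq⟩
        · simp
        · have := H q hq
          simp [h]
          omega
    · by_cases hy : a = y
      · subst hy
        rw [List.filter_cons_of_pos (by simp), List.isChain_cons_cons]
        constructor
        · intro H
          have := H [a] (by simp)
          simp [hx] at this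
        · rintro ⟨H, -⟩
          exact absurd rfl H
      · rw [List.filter_cons_of_neg (by simp [hx, hy]), ← ih x y h]
        constructor
        · intro H p hp
          have := H (a :: p) (by simpa using hp)
          simpa [hx, hy] using this
        · intro H p hp
          rcases List.prefix_cons_iff.1 hp with rfl | ⟨q, rfl, hq⟩
          · simp
          · simpa [hx, hy] using H q hq

theorem alternates_iff {V : Type*} [DecidableEq V] (w : List V) (x y : V) (h : x ≠ y) :
    Alternates w x y ↔ (Ahead w x y ∨ Ahead w y x) := by
  have e : (fun z => decide (z = y ∨ z = x)) = (fun z => decide (z = x ∨ z = y)) := by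
    funext z; simp [or_comm]
  rw [ahead_iff w x y h, ahead_iff w y x h.symm, e]
  unfold Alternates
  change List.IsChain _ _ ↔ _
  have hm : ∀ z ∈ w.filter (fun z => decide (z = x ∨ z = y)), z = x ∨ z = y := by
    intro z hz
    simpa using (List.mem_filter.1 hz).2
  generalize w.filter (fun z => decide (z = x ∨ z = y)) = f at hm ⊢
  cases f with
  | nil => simp
  | cons a t =>
    simp only [List.isChain_cons_cons]
    rcases hm a (by simp) with rfl | rfl
    · simp [h.symm]
    · simp [h]

/-- Normalized comparison of counts. -/
def Above {V : Type*} [DecidableEq V] (w : List V) (o : V → ℕ) (x y : V) : Prop :=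
  ∀ p, p <+: w → p.count y + o y ≤ p.count x + o x

theorem alternates_iff_above {V : Type*} [DecidableEq V] (w : List V) (o : V → ℕ) (c x y : V)
    (h : x ≠ y)
    (hx : ∀ p, p <+: w → p.count c ≤ p.count x + o x ∧ p.count x + o x ≤ p.count c + 1)
    (hy : ∀ p, p <+: w → p.count c ≤ p.count y + o y ∧ p.count y + o y ≤ p.count c + 1) :
    Alternates w x y ↔ (Above w o x y ∨ Above w o y x) := by
  rw [alternates_iff w x y h]
  have hx0 := hx [] (by simp)
  have hy0 := hy [] (by simp)
  simp at hx0 hy0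
  constructor
  · by_cases ho : o y ≤ o x
    · by_cases ho' : o x ≤ o y
      · rintro (H | H)
        · left; intro p hp; have := H p hp; omega
        · right; intro p hp; have := H p hp; omega
      · intro H
        left; intro p hp
        have := hx p hp
        have := hy p hp
        rcases H with H | H <;> have := H p hp <;> omega
    · intro H
      right; intro p hp
      have := hx p hp
      have := hy p hp
      rcases H with H | H <;> have := H p hp <;> omega
  · rintro (H | H)
    · have h0 := H [] (by simp)
      simp at h0
      by_cases ho : o x ≤ o y
      · left; intro p hp; have := H p hp; have := hx p hp; have := hy p hp; omega
      · right; intro p hp; have := H p hp; have := hx p hp; have := hy p hp; omega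
    · have h0 := H [] (by simp)
      simp at h0
      by_cases ho : o y ≤ o x
      · right; intro p hp; have := H p hp; have := hx p hp; have := hy p hp; omega
      · left; intro p hp; have := H p hp; have := hx p hp; have := hy p hp; omega

/-- `o` is a normalizing offset of `x` relative to `c`. -/
def IsOffset {V : Type*} [DecidableEq V] (w : List V) (c x : V) (o : ℕ) : Prop :=
  ∀ p, p <+: w → p.count c ≤ p.count x + o ∧ p.count x + o ≤ p.count c + 1

theorem cycle_logic (a a' b b' c c' d d' e e' : Prop)
    (k1 : a ∨ a') (k2 : b ∨ b') (k3 : c ∨ c') (k4 : d ∨ d') (k5 : e ∨ e')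
    (s1 : ¬ (a ∧ b) ∧ ¬ (b' ∧ a')) (s2 : ¬ (b ∧ c) ∧ ¬ (c' ∧ b'))
    (s3 : ¬ (c ∧ d) ∧ ¬ (d' ∧ c')) (s4 : ¬ (d ∧ e) ∧ ¬ (e' ∧ d'))
    (s5 : ¬ (e ∧ a) ∧ ¬ (a' ∧ e')) : False := by
  grind

theorem exists_offset {V : Type*} [DecidableEq V] (w : List V) (c x : V) (h : c ≠ x)
    (H : Alternates w c x) :
    ∃ o : ℕ, IsOffset w c x o := by
  rcases (alternates_iff w c x h).1 H with H | H
  · exact ⟨1, fun p hp => by have := H p hp; omega⟩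
  · exact ⟨0, fun p hp => by have := H p hp; omega⟩

theorem B2_not_wordRepresentable : ¬ WordRepresentable graphB2 := by
  rintro ⟨w, -, hw⟩
  have hoff : ∀ x : Fin 3 × Fin 3, ∃ o : ℕ, graphB2.Adj (1, 1) x →
      IsOffset w (1, 1) x o := by
    intro x
    by_cases hx : graphB2.Adj (1, 1) x
    · obtain ⟨o, ho⟩ := exists_offset w (1, 1) x hx.ne ((hw _ _ hx.ne).1 hx)
      exact ⟨o, fun _ => ho⟩
    · exact ⟨0, fun h => absurd h hx⟩
  choose o ho using hoff
  have key : ∀ x y, graphB2.Adj (1, 1) x → graphB2.Adj (1, 1) y → x ≠ y →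
      (graphB2.Adj x y ↔ (Above w o x y ∨ Above w o y x)) := fun x y hx hy h =>
    (hw x y h).trans (alternates_iff_above w o (1, 1) x y h (ho x hx) (ho y hy))
  have tr : ∀ x y z, Above w o x y → Above w o y z → Above w o x z :=
    fun x y z h1 h2 p hp => (h2 p hp).trans (h1 p hp)
  simp only [adjB2_iff] at key
  have k1 := (key (0, 1) (0, 2) (by decide) (by decide) (by decide)).1 (by decide)
  have k2 := (key (0, 2) (1, 2) (by decide) (by decide) (by decide)).1 (by decide)
  have k3 := (key (1, 2) (2, 1) (by decide) (by decide) (by decide)).1 (by decide)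
  have k4 := (key (2, 1) (2, 0) (by decide) (by decide) (by decide)).1 (by decide)
  have k5 := (key (2, 0) (0, 1) (by decide) (by decide) (by decide)).1 (by decide)
  have n1 := mt (key (0, 1) (1, 2) (by decide) (by decide) (by decide)).2 (by decide)
  have n2 := mt (key (0, 2) (2, 1) (by decide) (by decide) (by decide)).2 (by decide)
  have n3 := mt (key (1, 2) (2, 0) (by decide) (by decide) (by decide)).2 (by decide)
  have n4 := mt (key (2, 1) (0, 1) (by decide) (by decide) (by decide)).2 (by decide)
  have n5 := mt (key (2, 0) (0, 2) (by decide) (by decide) (by decide)).2 (by decide)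
  have step : ∀ x y z, ¬ (Above w o x z ∨ Above w o z x) →
      (¬ (Above w o x y ∧ Above w o y z) ∧ ¬ (Above w o z y ∧ Above w o y x)) :=
    fun x y z h => ⟨fun h' => h (Or.inl (tr _ _ _ h'.1 h'.2)),
      fun h' => h (Or.inr (tr _ _ _ h'.1 h'.2))⟩
  have s1 := step _ (0, 2) _ n1
  have s2 := step _ (1, 2) _ n2
  have s3 := step _ (2, 1) _ n3
  have s4 := step _ (2, 0) _ n4
  have s5 := step _ (0, 1) _ n5
  exact cycle_logic _ _ _ _ _ _ _ _ _ _ k1 k2 k3 k4 k5 s1 s2 s3 s4 s5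

theorem B2_not_colorable : ¬ graphB2.Colorable 3 := by
  rintro ⟨C⟩
  have v : ∀ x y, (x ≠ y ∧ ((x, y) ∈ edgesB2 ∨ (y, x) ∈ edgesB2)) → C x ≠ C y :=
    fun x y h => C.valid ((adjB2_iff x y).2 h)
  have col : ∀ h a : Fin 3, h ≠ a → ∀ b, h ≠ b → a ≠ b → ∀ c, h ≠ c → b ≠ c →
      ∀ d, h ≠ d → c ≠ d → ∀ e, h ≠ e → d ≠ e → e ≠ a → False := by decide
  exact col (C (1, 1)) (C (0, 1)) (v _ _ (by decide)) (C (0, 2)) (v _ _ (by decide))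
    (v _ _ (by decide)) (C (1, 2)) (v _ _ (by decide)) (v _ _ (by decide))
    (C (2, 1)) (v _ _ (by decide)) (v _ _ (by decide))
    (C (2, 0)) (v _ _ (by decide)) (v _ _ (by decide)) (v _ _ (by decide))

/-- The embedding of the wheel. -/
def wheelMap : Fin 5 ⊕ Unit → Fin 3 × Fin 3
  | Sum.inl i => ![(0, 1), (0, 2), (1, 2), (2, 1), (2, 0)] i
  | Sum.inr _ => (1, 1)

theorem wheel_embeds : Nonempty (wheelGraph 5 ↪g graphB2) := by
  refine ⟨⟨⟨wheelMap, by decide⟩, ?_⟩⟩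
  intro a b
  change graphB2.Adj (wheelMap a) (wheelMap b) ↔ _
  rw [adjB2_iff]
  unfold wheelGraph
  rw [SimpleGraph.fromRel_adj]
  rcases a with a | a <;> rcases b with b | b
  · revert a b; decide
  · revert a b; decide
  · revert a b; decide
  · revert a b; decide

/-- The graph `B2` contains the wheel `W_5` as an induced subgraph; consequently `B2`
is not 3-colourable and is not word-representable. -/
theorem graphB2_wheel5_not_colorable_not_wordRepresentable :
    Nonempty (wheelGraph 5 ↪g graphB2) ∧
      ¬ graphB2.Colorable 3 ∧ ¬ WordRepresentable graphB2 := by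
  exact ⟨wheel_embeds, B2_not_colorable, B2_not_wordRepresentable⟩
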